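/- There are absolute constants c₀ ≥ 10 and κ > 0 such that for every real c ≥ c₀ the following holds. Let m be a sufficiently large integer and let n = (1 − ε)·m be an integer with m^{−1/3} ≤ ε ≤ 1/c. Fix any history-independent insertion/deletion model at size n on m slots, let j ∈ J, and let s be an integer with j/6 ≤ s ≤ j/3. Draw t uniform in {⌈n/4⌉ − s, …, ⌊n/2⌋ − s}, start from A ∼ 𝒞_n, and perform a single insertion at rank t + s followed by a deletion at rank n+1, where before each operation x denotes the j-block starting at the position of the current rank-t element. Then with probability at least κ/(⌊j·Δ_j⌋ + 1), at least one of the two operations is critical to x. -/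

import Mathlib

open scoped BigOperators Classical

/-- Read slot `i` (mod `m`) of a cyclic array of `m` boolean slots. -/
def cyc (m : ℕ) (A : Fin m → Bool) (i : ℕ) : Bool :=
  if h : 0 < m then A ⟨i % m, Nat.mod_lt i h⟩ else false

/-- Number of occupied slots among the `j` cyclically consecutive slots
`p, p+1, …, p+j-1`. -/
def blockCount (m : ℕ) (A : Fin m → Bool) (p j : ℕ) : ℕ :=
  ((Finset.range j).filter (fun t => cyc m A (p + t) = true)).card

/-- Density of the `j`-block starting at slot `p`. -/
noncomputable def blockDensity (m : ℕ) (A : Fin m → Bool) (p j : ℕ) : ℝ :=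
  (blockCount m A p j : ℝ) / j

/-- A block is live (w.r.t. constant `c` and sparsity `ε`) if its density is
at least `1 - c·ε`. -/
def IsLive (c ε : ℝ) (m : ℕ) (A : Fin m → Bool) (p j : ℕ) : Prop :=
  1 - c * ε ≤ blockDensity m A p j

/-- Imbalance of a `j`-block (for even `j`): difference of the densities of its
two halves. -/
noncomputable def imbalance (m : ℕ) (A : Fin m → Bool) (p j : ℕ) : ℝ :=
  |blockDensity m A p (j / 2) - blockDensity m A (p + j / 2) (j / 2)|

/-- Adjusted imbalance: the imbalance if the block is live, `0` if it is dead. -/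
noncomputable def adjImbalance (c ε : ℝ) (m : ℕ) (A : Fin m → Bool) (p j : ℕ) : ℝ :=
  if IsLive c ε m A p j then imbalance m A p j else 0

/-- `Δ_j(A)`: the average adjusted imbalance over all `m` `j`-blocks. -/
noncomputable def DeltaAvg (c ε : ℝ) (m : ℕ) (A : Fin m → Bool) (j : ℕ) : ℝ :=
  (∑ p ∈ Finset.range m, adjImbalance c ε m A p j) / m

/-- `J = {2, 4, 8, …, 2^(⌊log₂ m⌋ - 2)}`. -/
def Jset (m : ℕ) : Finset ℕ := (Finset.Icc 1 (Nat.log 2 m - 2)).image (fun i => 2 ^ i)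

/-- The potential `φ` of a `j`-block: `0` if dead, `(μ - (1 - c·ε))²` if live,
where `μ` is its density. -/
noncomputable def potential (c ε : ℝ) (m : ℕ) (A : Fin m → Bool) (p j : ℕ) : ℝ :=
  if IsLive c ε m A p j then (blockDensity m A p j - (1 - c * ε)) ^ 2 else 0

/-- An array configuration on `m` slots with `k` elements: a boolean occupancy
vector with exactly `k` occupied slots. -/
abbrev Config (m k : ℕ) :=
  {A : Fin m → Bool // (Finset.univ.filter (fun i => A i = true)).card = k}

/-- Expectation of a real-valued function under a probability mass function on a
finite type. -/
noncomputable def pexp {α : Type*} [Fintype α] (p : PMF α) (f : α → ℝ) : ℝ :=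
  ∑ a, (p a).toReal * f a

/-- Probability of an event under a probability mass function on a finite type. -/
noncomputable def pprob {α : Type*} [Fintype α] (p : PMF α) (E : α → Prop) : ℝ :=
  pexp p (fun a => if E a then 1 else 0)

/-- `posOf A s` is the position (0-indexed slot) of the rank-`s` element of `A`,
i.e. the `s`-th smallest occupied slot (`s` is 1-indexed). -/
def posOf {m : ℕ} (A : Fin m → Bool) (s : ℕ) : ℕ :=
  (((List.range m).filter (fun i => cyc m A i))).getD (s - 1) 0

/-- A history-independent insertion/deletion model at size `n` on `m` slots:
distributions `C0` (on `n`-element configurations) and `C1` (on `(n+1)`-element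
configurations), insertion couplings `ins r` for each rank `r ∈ {1, …, n+1}`,
and a deletion coupling `del` for rank `n+1`, all with marginals `C0` and `C1`. -/
structure HIModel (m n : ℕ) where
  C0 : PMF (Config m n)
  C1 : PMF (Config m (n + 1))
  ins : ℕ → PMF (Config m n × Config m (n + 1))
  del : PMF (Config m n × Config m (n + 1))
  ins_fst : ∀ r, 1 ≤ r → r ≤ n + 1 → PMF.map Prod.fst (ins r) = C0
  ins_snd : ∀ r, 1 ≤ r → r ≤ n + 1 → PMF.map Prod.snd (ins r) = C1
  del_fst : PMF.map Prod.fst del = C0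
  del_snd : PMF.map Prod.snd del = C1

/-- The coupling `p` conditioned on its first coordinate being `A` (junk value
`p` itself when the conditioning event is null; such states are reached with
probability zero). -/
noncomputable def condFst {m n : ℕ} (p : PMF (Config m n × Config m (n + 1)))
    (A : Config m n) : PMF (Config m n × Config m (n + 1)) :=
  if h : ∃ q ∈ {q : Config m n × Config m (n + 1) | q.1 = A}, q ∈ p.support then
    p.filter {q | q.1 = A} h
  else p

/-- The coupling `p` conditioned on its second coordinate being `A'`. -/
noncomputable def condSnd {m n : ℕ} (p : PMF (Config m n × Config m (n + 1)))
    (A' : Config m (n + 1)) : PMF (Config m n × Config m (n + 1)) :=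
  if h : ∃ q ∈ {q : Config m n × Config m (n + 1) | q.2 = A'}, q ∈ p.support then
    p.filter {q | q.2 = A'} h
  else p

/-- Rank of an old element after an insertion at rank `r`. -/
def insShift (r s : ℕ) : ℕ := if s < r then s else s + 1

/-- The (cyclic) slots of the 1st, `(j/2)`-th and `j`-th positions of the
`j`-block starting at slot `p`: the slots of the boundary set `B(x)`. -/
def boundarySlots (m p j : ℕ) : Finset ℕ :=
  {p % m, (p + j / 2 - 1) % m, (p + j - 1) % m}

/-- An insertion at rank `r` realized by the pair `(A0, A1)` is critical to the
`j`-block of `A0` starting at slot `p`: the block is live in `A0` and some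
element of its boundary set is rearranged. -/
def InsCritical (c : ℝ) (m n r j p : ℕ) (A0 : Config m n) (A1 : Config m (n + 1)) : Prop :=
  IsLive c (1 - (n : ℝ) / m) m A0.1 p j ∧
  ∃ s ∈ Finset.Icc 1 n, posOf A0.1 s ∈ boundarySlots m p j ∧
    posOf A0.1 s ≠ posOf A1.1 (insShift r s)

/-- A deletion at rank `n+1` realized by the pair `(A0, A1)` (`A1` before, `A0`
after) is critical to the `j`-block of `A1` starting at slot `p`. -/
def DelCritical (c : ℝ) (m n j p : ℕ) (A0 : Config m n) (A1 : Config m (n + 1)) : Prop :=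
  IsLive c (1 - ((n : ℝ) + 1) / m) m A1.1 p j ∧
  ∃ s ∈ Finset.Icc 1 n, posOf A1.1 s ∈ boundarySlots m p j ∧
    posOf A1.1 s ≠ posOf A0.1 s

/-- Probability that, starting from configuration `A` and performing `k`
insertion/deletion pairs (insertion at rank `r`, deletion at rank `n+1`),
no operation is critical to the `j`-block starting at the position of the
current rank-`t` element (in the configuration just before that operation). -/
noncomputable def probNoCrit (c : ℝ) {m n : ℕ} (Mo : HIModel m n) (t r j : ℕ) :
    ℕ → Config m n → ℝ
  | 0, _ => 1
  | k + 1, A =>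
      pexp (condFst (Mo.ins r) A) fun q =>
        if InsCritical c m n r j (posOf q.1.1 t) q.1 q.2 then 0
        else pexp (condSnd Mo.del q.2) fun q' =>
          if DelCritical c m n j (posOf q'.2.1 t) q'.1 q'.2 then 0
          else probNoCrit c Mo t r j k q'.1

/-- `Δ_j` for the stationary distribution `C0` of a model. -/
noncomputable def DeltaExp (c : ℝ) {m n : ℕ} (Mo : HIModel m n) (j : ℕ) : ℝ :=
  pexp Mo.C0 (fun A => DeltaAvg c (1 - (n : ℝ) / m) m A.1 j)

section Prob

lemma pexp_map {α β : Type*} [Fintype α] [Fintype β] (p : PMF α) (f : α → β) (g : β → ℝ) :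
    pexp (p.map f) g = pexp p (fun a => g (f a)) := by
  unfold pexp
  have h : ∀ b, ((p.map f) b).toReal = ∑ a, if b = f a then (p a).toReal else 0 := by
    intro b
    rw [PMF.map_apply, tsum_fintype, ENNReal.toReal_sum]
    · refine Finset.sum_congr rfl fun a _ => ?_
      split_ifs <;> simp
    · intro a _
      split_ifs
      · exact p.apply_ne_top a
      · simp
  simp_rw [h, Finset.sum_mul]
  rw [Finset.sum_comm]
  refine Finset.sum_congr rfl fun a _ => ?_
  simp [ite_mul]

lemma pexp_one {α : Type*} [Fintype α] (p : PMF α) : pexp p (fun _ => 1) = 1 := by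
  unfold pexp
  have := p.tsum_coe
  rw [tsum_fintype] at this
  simp only [mul_one]
  rw [← ENNReal.toReal_sum (fun a _ => p.apply_ne_top a), this]
  simp

lemma pexp_const {α : Type*} [Fintype α] (p : PMF α) (x : ℝ) : pexp p (fun _ => x) = x := by
  have := pexp_one p
  unfold pexp at *
  simp only [mul_one] at this
  rw [← Finset.sum_mul, this, one_mul]

noncomputable def condGen {α β : Type*} (f : α → β) (p : PMF α) (b : β) : PMF α :=
  if h : ∃ q ∈ {q : α | f q = b}, q ∈ p.support then p.filter {q | f q = b} h else p

lemma condGen_mul {α β : Type*} [Fintype α] (f : α → β) (p : PMF α) (b : β) (q : α) :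
    ((p.map f) b).toReal * (condGen f p b q).toReal = if f q = b then (p q).toReal else 0 := by
  have hS : (p.map f) b = ∑' a, ({q | f q = b} : Set α).indicator p a := by
    rw [PMF.map_apply]
    congr 1
    ext a
    simp only [Set.indicator_apply, Set.mem_ofPred_eq]
    simp only [eq_comm]
  unfold condGen
  split_ifs with h h2 h2
  · rw [PMF.filter_apply, ← hS, ← ENNReal.toReal_mul]
    have h0 : (p.map f) b ≠ 0 := by
      obtain ⟨q, hq, hq'⟩ := h
      rw [← PMF.mem_support_iff, PMF.support_map]
      exact ⟨q, hq', hq⟩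
    rw [mul_comm, mul_assoc, ENNReal.inv_mul_cancel h0 ((p.map f).apply_ne_top b), mul_one]
    simp [Set.indicator_apply, h2]
  · rw [PMF.filter_apply]
    simp [h2]
  · have : p q = 0 := by
      by_contra h3
      exact h ⟨q, h2, (PMF.mem_support_iff _ _).2 h3⟩
    simp [this]
  · have : (p.map f) b = 0 := by
      by_contra h3
      rw [← ne_eq, ← PMF.mem_support_iff, PMF.support_map] at h3
      obtain ⟨a, ha, hb⟩ := h3
      exact h ⟨a, hb, ha⟩
    simp [this]

lemma pexp_condGen {α β : Type*} [Fintype α] [Fintype β] (f : α → β) (p : PMF α) (F : α → ℝ) :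
    pexp (p.map f) (fun b => pexp (condGen f p b) F) = pexp p F := by
  unfold pexp
  simp_rw [Finset.mul_sum, ← mul_assoc, condGen_mul]
  rw [Finset.sum_comm]
  refine Finset.sum_congr rfl fun a _ => ?_
  simp [ite_mul]

lemma condFst_eq {m n : ℕ} (p : PMF (Config m n × Config m (n + 1))) (A : Config m n) :
    condFst p A = condGen Prod.fst p A := by
  unfold condFst condGen
  by_cases h : ∃ q ∈ {q : Config m n × Config m (n + 1) | q.1 = A}, q ∈ p.support
  · rw [dif_pos h, dif_pos h]
  · rw [dif_neg h, dif_neg h]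

lemma condSnd_eq {m n : ℕ} (p : PMF (Config m n × Config m (n + 1))) (A : Config m (n+1)) :
    condSnd p A = condGen Prod.snd p A := by
  unfold condSnd condGen
  by_cases h : ∃ q ∈ {q : Config m n × Config m (n + 1) | q.2 = A}, q ∈ p.support
  · rw [dif_pos h, dif_pos h]
  · rw [dif_neg h, dif_neg h]

lemma prob_core (c : ℝ) {m n : ℕ} (Mo : HIModel m n) (t r j : ℕ) (hr : 1 ≤ r) (hr' : r ≤ n + 1)
    (good g : Config m n → ℝ) (C : ℝ)
    (hlow : ∀ A B, good A - C ≤ g B - g A)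
    (hstep : ∀ (A B : Config m n) (A1 : Config m (n+1)),
      ¬ InsCritical c m n r j (posOf A.1 t) A A1 →
      ¬ DelCritical c m n j (posOf A1.1 t) B A1 → good A ≤ g B - g A) :
    pexp Mo.C0 good ≤ C * (1 - pexp Mo.C0 (fun A => probNoCrit c Mo t r j 1 A)) := by
  set N : Config m n × Config m (n + 1) → Config m n × Config m (n + 1) → ℝ := fun q q' =>
    if InsCritical c m n r j (posOf q.1.1 t) q.1 q.2 then 0 else
      if DelCritical c m n j (posOf q'.2.1 t) q'.1 q'.2 then 0 else 1 with hN
  have hQ : pexp Mo.C0 (fun A => probNoCrit c Mo t r j 1 A) =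
      pexp (Mo.ins r) (fun q => pexp (condGen Prod.snd Mo.del q.2) (N q)) := by
    rw [← Mo.ins_fst r hr hr', ← pexp_condGen Prod.fst (Mo.ins r)]
    simp only [probNoCrit, condFst_eq, condSnd_eq]
    congr 1
    ext A
    congr 1
    ext q
    simp only [hN]
    split_ifs with h
    · rw [pexp_const]
    · rfl
  have hb : ∀ φ : Config m n → ℝ,
      pexp (Mo.ins r) (fun q => pexp (condGen Prod.snd Mo.del q.2) (fun q' => φ q'.1))
        = pexp Mo.C0 φ := by
    intro φ
    rw [← pexp_map (Mo.ins r) Prod.snd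
      (fun B => pexp (condGen Prod.snd Mo.del B) (fun q' => φ q'.1)),
      Mo.ins_snd r hr hr', ← Mo.del_snd, pexp_condGen, ← pexp_map Mo.del Prod.fst, Mo.del_fst]
  have ha : ∀ φ : Config m n → ℝ,
      pexp (Mo.ins r) (fun q => pexp (condGen Prod.snd Mo.del q.2) (fun _ => φ q.1))
        = pexp Mo.C0 φ := by
    intro φ
    simp_rw [pexp_const]
    rw [← pexp_map (Mo.ins r) Prod.fst, Mo.ins_fst r hr hr']
  have h1 : pexp (Mo.ins r) (fun q => pexp (condGen Prod.snd Mo.del q.2) (fun _ => (1:ℝ))) = 1 := by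
    simp_rw [pexp_const]
  have key : pexp (Mo.ins r) (fun q => pexp (condGen Prod.snd Mo.del q.2)
      (fun q' => good q.1 - C * (1 - N q q'))) ≤
      pexp (Mo.ins r) (fun q => pexp (condGen Prod.snd Mo.del q.2)
      (fun q' => g q'.1 - g q.1)) := by
    refine Finset.sum_le_sum fun q _ => ?_
    by_cases hq : Mo.ins r q = 0
    · simp [hq]
    refine mul_le_mul_of_nonneg_left ?_ ENNReal.toReal_nonneg
    refine Finset.sum_le_sum fun q' _ => ?_
    by_cases hq2 : q'.2 = q.2
    · refine mul_le_mul_of_nonneg_left ?_ ENNReal.toReal_nonneg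
      simp only [hN]
      split_ifs with h1 h2
      · have := hlow q.1 q'.1; linarith
      · have := hlow q.1 q'.1; linarith
      · have := hstep q.1 q'.1 q.2 h1 (by rw [← hq2]; exact h2); linarith
    · have h2 := condGen_mul Prod.snd Mo.del q.2 q'
      rw [if_neg hq2, Mo.del_snd, ← Mo.ins_snd r hr hr'] at h2
      have h3 : ((PMF.map Prod.snd (Mo.ins r)) q.2).toReal ≠ 0 := by
        rw [ENNReal.toReal_ne_zero]
        refine ⟨?_, PMF.apply_ne_top _ _⟩
        rw [← PMF.mem_support_iff, PMF.support_map]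
        exact ⟨q, (PMF.mem_support_iff _ _).2 hq, rfl⟩
      rcases mul_eq_zero.1 h2 with h4 | h4
      · exact absurd h4 h3
      · rw [h4]; simp
  have e2 : ∀ F G : Config m n × Config m (n + 1) → Config m n × Config m (n + 1) → ℝ,
      ∀ x : ℝ, pexp (Mo.ins r) (fun q => pexp (condGen Prod.snd Mo.del q.2)
        (fun q' => F q q' - x * G q q')) =
      pexp (Mo.ins r) (fun q => pexp (condGen Prod.snd Mo.del q.2) (F q)) -
      x * pexp (Mo.ins r) (fun q => pexp (condGen Prod.snd Mo.del q.2) (G q)) := by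
    intro F G x
    simp only [pexp, mul_sub, Finset.sum_sub_distrib, Finset.mul_sum]
    congr 1
    refine Finset.sum_congr rfl fun q _ => Finset.sum_congr rfl fun q' _ => by ring
  have r1 := e2 (fun q _ => good q.1) (fun q q' => 1 - N q q') C
  have r2 := e2 (fun _ _ => 1) (fun q q' => N q q') 1
  have r3 := e2 (fun _ q' => g q'.1) (fun q _ => g q.1) 1
  simp only [one_mul] at r2 r3
  rw [r1, r3, r2, ha, ha, hb, h1] at key
  rw [hQ]
  linarith

end Prob
section Comb

def cnt (m : ℕ) (A : Fin m → Bool) (i : ℕ) : ℕ := Nat.count (fun i => cyc m A i = true) i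

lemma cnt_succ_of (m : ℕ) (A : Fin m → Bool) (i : ℕ) (h : cyc m A i = true) :
    cnt m A (i + 1) = cnt m A i + 1 := by
  unfold cnt; rw [Nat.count_succ]; simp [h]

lemma cnt_blockCount (m : ℕ) (A : Fin m → Bool) (p j : ℕ) :
    cnt m A (p + j) = cnt m A p + blockCount m A p j := by
  unfold cnt blockCount
  rw [Nat.count_add, Nat.count_eq_card_filter_range (fun k => cyc m A (p + k) = true)]

lemma list_getD (P : ℕ → Bool) (m i : ℕ) (hi : i < Nat.count (fun i => P i = true) m) :
    ((List.range m).filter P).getD i 0 < m ∧ P (((List.range m).filter P).getD i 0) = true ∧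
    Nat.count (fun i => P i = true) (((List.range m).filter P).getD i 0) = i := by
  have hlen : ∀ m, ((List.range m).filter P).length = Nat.count (fun i => P i = true) m := by
    intro m
    rw [Nat.count, List.countP_eq_length_filter]
    simp
  induction m with
  | zero => simp at hi
  | succ m ih =>
    rw [List.range_succ, List.filter_append]
    by_cases h : i < Nat.count (fun i => P i = true) m
    · rw [List.getD_append _ _ _ _ (by rw [hlen]; exact h)]
      obtain ⟨a, b, c⟩ := ih h
      exact ⟨by omega, b, c⟩
    · rw [List.getD_append_right _ _ _ _ (by rw [hlen]; omega), hlen]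
      rw [Nat.count_succ] at hi
      by_cases hP : P m = true
      · rw [if_pos hP] at hi
        have : i = Nat.count (fun i => P i = true) m := by omega
        subst this
        simp [hP]
      · rw [if_neg hP] at hi
        omega

lemma cyc_periodic (m : ℕ) (A : Fin m → Bool) :
    Function.Periodic (fun i => cyc m A i = true) m := by
  intro x
  simp [cyc]

lemma cnt_m {m k : ℕ} (A : Config m k) : cnt m A.1 m = k := by
  have h := A.2
  unfold cnt
  rw [Nat.count_eq_card_filter_range]
  refine Eq.trans ?_ h
  symm
  refine Finset.card_bij (fun i _ => i.1) ?_ ?_ ?_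
  · intro a ha
    simp only [Finset.mem_filter, Finset.mem_univ, true_and, Finset.mem_range] at *
    refine ⟨a.2, ?_⟩
    have : 0 < m := by have := a.2; omega
    simp [cyc, this, Nat.mod_eq_of_lt a.2, ha]
  · intro a _ b _ hab
    exact Fin.ext hab
  · intro b hb
    simp only [Finset.mem_filter, Finset.mem_univ, true_and, Finset.mem_range] at *
    obtain ⟨h1, h2⟩ := hb
    have : 0 < m := by omega
    refine ⟨⟨b, h1⟩, ?_, rfl⟩
    simpa [cyc, this, Nat.mod_eq_of_lt h1] using h2

lemma posOf_spec {m k : ℕ} (A : Config m k) (s : ℕ) (hs : 1 ≤ s) (hs' : s ≤ k) :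
    posOf A.1 s < m ∧ cyc m A.1 (posOf A.1 s) = true ∧ cnt m A.1 (posOf A.1 s) + 1 = s := by
  have := list_getD (fun i => cyc m A.1 i) m (s - 1) (by
    have := cnt_m A
    unfold cnt at this
    rw [this]; omega)
  obtain ⟨a, b, c⟩ := this
  refine ⟨a, b, ?_⟩
  unfold cnt posOf
  rw [c]; omega

lemma posOf_unique {m k : ℕ} (A : Config m k) (s p : ℕ) (hs : 1 ≤ s) (hs' : s ≤ k)
    (hp : cyc m A.1 p = true) (hc : cnt m A.1 p + 1 = s) : posOf A.1 s = p := by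
  obtain ⟨a, b, c⟩ := posOf_spec A s hs hs'
  refine Nat.count_injective (p := fun i => cyc m A.1 i = true) b hp ?_
  unfold cnt at *; omega

lemma cnt_le_add (m : ℕ) (A : Fin m → Bool) (p q : ℕ) : cnt m A (p + q) ≤ cnt m A p + q := by
  unfold cnt
  rw [Nat.count_add]
  have := Nat.count_le (p := fun k => cyc m A (p + k) = true) (n := q)
  omega

lemma blockCount_le (m : ℕ) (A : Fin m → Bool) (p j : ℕ) : blockCount m A p j ≤ j := by
  unfold blockCount
  refine (Finset.card_filter_le _ _).trans ?_
  simp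

lemma posOf_bound {m k : ℕ} (A : Config m k) (s : ℕ) (hs : 1 ≤ s) (hs' : s ≤ k) :
    posOf A.1 s + k + 1 ≤ m + s := by
  obtain ⟨a, b, c⟩ := posOf_spec A s hs hs'
  have h := cnt_le_add m A.1 (posOf A.1 s) (m - posOf A.1 s)
  rw [Nat.add_sub_cancel' a.le, cnt_m] at h
  omega

/-- `posOf A t = p`, `posOf A (t+h-1) = p + d - 1` gives block count `h`. -/
lemma blockCount_of_pos {m k : ℕ} (A : Config m k) (t h p d : ℕ) (ht : 1 ≤ t) (hd : 1 ≤ d)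
    (htk : t ≤ k) (hhk : t + h ≤ k) (hp : posOf A.1 t = p) (hp' : posOf A.1 (t + h) = p + d - 1) :
    blockCount m A.1 p d = h + 1 ∧ cyc m A.1 (p + d - 1) = true := by
  obtain ⟨a, b, c⟩ := posOf_spec A t ht htk
  obtain ⟨a', b', c'⟩ := posOf_spec A (t + h) (by omega) hhk
  rw [hp] at a b c
  rw [hp'] at a' b' c'
  refine ⟨?_, b'⟩
  have h1 := cnt_succ_of m A.1 _ b'
  rw [show p + d - 1 + 1 = p + d by omega, cnt_blockCount] at h1
  omega

lemma pos_of_blockCount {m k : ℕ} (A : Config m k) (t h p d : ℕ) (ht : 1 ≤ t) (hd : 1 ≤ d)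
    (htk : t ≤ k) (hhk : t + h ≤ k) (hp : posOf A.1 t = p)
    (hb : blockCount m A.1 p d = h + 1) (hc : cyc m A.1 (p + d - 1) = true) :
    posOf A.1 (t + h) = p + d - 1 := by
  obtain ⟨a, b, c⟩ := posOf_spec A t ht htk
  rw [hp] at a b c
  refine posOf_unique A _ _ (by omega) hhk hc ?_
  have h1 := cnt_succ_of m A.1 _ hc
  rw [show p + d - 1 + 1 = p + d by omega, cnt_blockCount] at h1
  omega

structure Good (θ : ℝ) (m : ℕ) (A : Fin m → Bool) (p j s : ℕ) : Prop where
  mid : cyc m A (p + j / 2 - 1) = true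
  last : cyc m A (p + j - 1) = true
  half : s + 1 ≤ blockCount m A p (j / 2)
  live : θ ≤ blockCount m A p j

def Dval (m : ℕ) (A : Fin m → Bool) (p j : ℕ) : ℤ :=
  2 * (blockCount m A p (j / 2) : ℤ) - blockCount m A p j

lemma step_lemma (c θ : ℝ) {m n : ℕ} (A0 B0 : Config m n) (A1 : Config m (n + 1)) (t s j : ℕ)
    (ht : 1 ≤ t) (hs : 1 ≤ s) (hj : 2 ≤ j) (htn : t + j ≤ n)
    (hθ : (1 - c * (1 - (n : ℝ) / m)) * j ≤ θ)
    (hθ' : (1 - c * (1 - ((n : ℝ) + 1) / m)) * j ≤ θ)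
    (hg : Good θ m A0.1 (posOf A0.1 t) j s)
    (hI : ¬ InsCritical c m n (t + s) j (posOf A0.1 t) A0 A1)
    (hD : ¬ DelCritical c m n j (posOf A1.1 t) B0 A1) :
    Good θ m B0.1 (posOf B0.1 t) j s ∧
      Dval m B0.1 (posOf B0.1 t) j = Dval m A0.1 (posOf A0.1 t) j + 1 := by
  obtain ⟨g1, g2, g3, g4⟩ := hg
  have hj0 : (0 : ℝ) < j := by exact_mod_cast (by omega : 0 < j)
  set p := posOf A0.1 t with hp
  have hpb := posOf_bound A0 t ht (by omega)
  rw [← hp] at hpb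
  have hpj : p + j ≤ m := by omega
  obtain ⟨h, hh⟩ : ∃ h, blockCount m A0.1 p (j / 2) = h + 1 := ⟨_, (Nat.sub_add_cancel (by omega)).symm⟩
  obtain ⟨H, hH⟩ : ∃ H, blockCount m A0.1 p j = H + 1 := by
    refine ⟨blockCount m A0.1 p j - 1, (Nat.sub_add_cancel ?_).symm⟩
    have e := cnt_blockCount m A0.1 p j
    have e' := cnt_blockCount m A0.1 p (j / 2)
    have : cnt m A0.1 (p + j / 2) ≤ cnt m A0.1 (p + j) := Nat.count_monotone _ (by omega)
    omega
  have hhH : h ≤ H := by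
    have e := cnt_blockCount m A0.1 p j
    have e' := cnt_blockCount m A0.1 p (j / 2)
    have : cnt m A0.1 (p + j / 2) ≤ cnt m A0.1 (p + j) := Nat.count_monotone _ (by omega)
    omega
  have hHj : H + 1 ≤ j := hH ▸ blockCount_le m A0.1 p j
  have hm1 : p % m = p := Nat.mod_eq_of_lt (by omega)
  have hm2 : (p + j / 2 - 1) % m = p + j / 2 - 1 := Nat.mod_eq_of_lt (by omega)
  have hm3 : (p + j - 1) % m = p + j - 1 := Nat.mod_eq_of_lt (by omega)
  have q2 := pos_of_blockCount A0 t h p (j / 2) ht (by omega) (by omega) (by omega) rfl hh g1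
  have q3 := pos_of_blockCount A0 t H p j ht (by omega) (by omega) (by omega) rfl hH g2
  have hI' : ∀ s' ∈ Finset.Icc 1 n, posOf A0.1 s' ∈ boundarySlots m p j →
      posOf A0.1 s' = posOf A1.1 (insShift (t + s) s') := by
    intro s' h1 h2
    by_contra h3
    refine hI ⟨?_, s', h1, h2, h3⟩
    unfold IsLive blockDensity
    rw [le_div_iff₀ hj0]
    linarith
  simp only [boundarySlots, hm1, hm2, hm3, Finset.mem_insert, Finset.mem_singleton,
    Finset.mem_Icc] at hI'
  have i1 := hI' t ⟨ht, by omega⟩ (Or.inl rfl)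
  have i2 := hI' (t + h) ⟨by omega, by omega⟩ (Or.inr (Or.inl q2))
  have i3 := hI' (t + H) ⟨by omega, by omega⟩ (Or.inr (Or.inr q3))
  rw [insShift, if_pos (by omega), ← hp] at i1
  rw [insShift, if_neg (by omega), q2] at i2
  rw [insShift, if_neg (by omega), q3] at i3
  obtain ⟨b2, -⟩ := blockCount_of_pos A1 t (h + 1) p (j / 2) ht (by omega) (by omega) (by omega)
    i1.symm i2.symm
  obtain ⟨b3, -⟩ := blockCount_of_pos A1 t (H + 1) p j ht (by omega) (by omega) (by omega)
    i1.symm i3.symm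
  have hD' : ∀ s' ∈ Finset.Icc 1 n, posOf A1.1 s' ∈ boundarySlots m p j →
      posOf A1.1 s' = posOf B0.1 s' := by
    intro s' h1 h2
    by_contra h3
    rw [← i1] at hD
    refine hD ⟨?_, s', h1, h2, h3⟩
    unfold IsLive blockDensity
    rw [le_div_iff₀ hj0, b3]
    rw [hH] at g4
    push_cast at *
    linarith
  simp only [boundarySlots, hm1, hm2, hm3, Finset.mem_insert, Finset.mem_singleton,
    Finset.mem_Icc] at hD'
  have d1 := hD' t ⟨ht, by omega⟩ (Or.inl i1.symm)
  have d2 := hD' (t + h + 1) ⟨by omega, by omega⟩ (Or.inr (Or.inl i2.symm))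
  have d3 := hD' (t + H + 1) ⟨by omega, by omega⟩ (Or.inr (Or.inr i3.symm))
  rw [← i1] at d1
  rw [← i2] at d2
  rw [← i3] at d3
  rw [← d1]
  obtain ⟨c2, c2'⟩ := blockCount_of_pos B0 t (h + 1) p (j / 2) ht (by omega) (by omega) (by omega)
    d1.symm d2.symm
  obtain ⟨c3, c3'⟩ := blockCount_of_pos B0 t (H + 1) p j ht (by omega) (by omega) (by omega)
    d1.symm d3.symm
  refine ⟨⟨c2', c3', by omega, ?_⟩, ?_⟩
  · rw [c3]; rw [hH] at g4; push_cast at *; linarith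
  · unfold Dval; rw [c2, c3, hh, hH]; push_cast; ring

end Comb
section Fin

lemma sum_cyc {m k : ℕ} (A : Config m k) (d : ℕ) :
    ∑ p ∈ Finset.range m, (if cyc m A.1 (p + d) = true then (1 : ℝ) else 0) = k := by
  have h := Nat.filter_Ico_card_eq_of_periodic d m (fun i => cyc m A.1 i = true)
    (cyc_periodic m A.1)
  have h2 : Nat.count (fun i => cyc m A.1 i = true) m = k := cnt_m A
  rw [h2] at h
  have h3 : (((Finset.Ico d (d + m)).filter (fun i => cyc m A.1 i = true)).card : ℝ) = k := by
    exact_mod_cast h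
  refine Eq.trans ?_ h3
  rw [Finset.card_filter, Finset.sum_Ico_eq_sum_range]
  push_cast
  simp [add_comm]

lemma sum_blockCount {m k : ℕ} (A : Config m k) (l : ℕ) :
    ∑ p ∈ Finset.range m, (blockCount m A.1 p l : ℝ) = l * k := by
  unfold blockCount
  simp_rw [Finset.card_filter]
  push_cast
  rw [Finset.sum_comm]
  simp_rw [sum_cyc]
  simp

lemma blockCount_split (m : ℕ) (A : Fin m → Bool) (p a b : ℕ) :
    blockCount m A p (a + b) = blockCount m A p a + blockCount m A (p + a) b := by
  have h1 := cnt_blockCount m A p (a + b)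
  have h2 := cnt_blockCount m A p a
  have h3 := cnt_blockCount m A (p + a) b
  rw [← add_assoc] at h1
  omega

lemma imbalance_eq (m : ℕ) (A : Fin m → Bool) (p i : ℕ) (hi : 1 ≤ i) :
    |(Dval m A p (2 * i) : ℝ)| = i * imbalance m A p (2 * i) := by
  have hi0 : (0 : ℝ) < i := by exact_mod_cast hi
  unfold imbalance Dval blockDensity
  rw [show 2 * i / 2 = i by omega, ← sub_div, abs_div, abs_of_pos hi0, mul_div_cancel₀ _ hi0.ne']
  congr 1
  rw [two_mul i, blockCount_split]
  push_cast
  ring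

noncomputable def goodF (θ : ℝ) (K : ℕ) (m : ℕ) (A : Fin m → Bool) (p j s : ℕ) : ℝ :=
  if Good θ m A p j s ∧ |Dval m A p j| < K then 1 else 0

noncomputable def gF (θ : ℝ) (K : ℕ) (m : ℕ) (A : Fin m → Bool) (p j s : ℕ) : ℤ :=
  if Good θ m A p j s then max (-K) (min K (Dval m A p j)) else -K

lemma gF_bd (θ : ℝ) (K : ℕ) (m : ℕ) (A : Fin m → Bool) (p j s : ℕ) :
    -(K : ℝ) ≤ gF θ K m A p j s ∧ (gF θ K m A p j s : ℝ) ≤ K := by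
  have : -(K : ℤ) ≤ gF θ K m A p j s ∧ gF θ K m A p j s ≤ K := by
    unfold gF; split_ifs <;> omega
  exact_mod_cast this

lemma goodF_le_one (θ : ℝ) (K : ℕ) (m : ℕ) (A : Fin m → Bool) (p j s : ℕ) :
    goodF θ K m A p j s ≤ 1 := by
  unfold goodF; split_ifs <;> norm_num

lemma markov (c ε θ : ℝ) (K : ℕ) (hK : 0 < K) (m : ℕ) (A : Fin m → Bool) (p i s : ℕ) (hi : 1 ≤ i)
    (hs : 3 * s ≤ 2 * i) (hθ : (1 - c * ε) * (2 * i) ≤ θ) (hθ2 : θ < 2 * i) :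
    1 - goodF θ K m A p (2 * i) s ≤
      (2 * i - blockCount m A p (2 * i)) / (2 * i - θ) + 3 / i * (i - blockCount m A p i)
      + (1 - (if cyc m A (p + (i - 1)) = true then (1 : ℝ) else 0))
      + (1 - (if cyc m A (p + (2 * i - 1)) = true then (1 : ℝ) else 0))
      + i / K * adjImbalance c ε m A p (2 * i) := by
  have hi0 : (0 : ℝ) < i := by exact_mod_cast hi
  have hK0 : (0 : ℝ) < K := by exact_mod_cast hK
  have b1 : (blockCount m A p (2 * i) : ℝ) ≤ 2 * i := by exact_mod_cast blockCount_le m A p (2 * i)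
  have b2 : (blockCount m A p i : ℝ) ≤ i := by exact_mod_cast blockCount_le m A p i
  have n1 : 0 ≤ (2 * i - blockCount m A p (2 * i) : ℝ) / (2 * i - θ) :=
    div_nonneg (by linarith) (by linarith)
  have n2 : 0 ≤ 3 / (i : ℝ) * (i - blockCount m A p i) :=
    mul_nonneg (by positivity) (by linarith)
  have n3 : ∀ q, 0 ≤ 1 - (if cyc m A q = true then (1 : ℝ) else 0) := by
    intro q; split_ifs <;> norm_num
  have n5 : 0 ≤ i / K * adjImbalance c ε m A p (2 * i) := by
    refine mul_nonneg (by positivity) ?_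
    unfold adjImbalance imbalance
    split_ifs
    · positivity
    · exact le_rfl
  have n3a := n3 (p + (i - 1))
  have n3b := n3 (p + (2 * i - 1))
  by_cases hg : Good θ m A p (2 * i) s ∧ |Dval m A p (2 * i)| < K
  · unfold goodF; rw [if_pos hg]; linarith
  have hgz : goodF θ K m A p (2 * i) s = 0 := by unfold goodF; rw [if_neg hg]
  rw [hgz]
  by_cases h1 : cyc m A (p + (i - 1)) = true
  swap
  · rw [if_neg h1]; linarith
  by_cases h2 : cyc m A (p + (2 * i - 1)) = true
  swap
  · rw [if_neg h2]; linarith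
  by_cases h3 : s + 1 ≤ blockCount m A p i
  swap
  · have h4 : 3 * (blockCount m A p i) ≤ 2 * i := by omega
    have h5 : 3 * (blockCount m A p i : ℝ) ≤ 2 * i := by exact_mod_cast h4
    have : 1 ≤ 3 / (i : ℝ) * (i - blockCount m A p i) := by
      rw [div_mul_eq_mul_div, le_div_iff₀ hi0]; linarith
    linarith
  by_cases h4 : θ ≤ blockCount m A p (2 * i)
  swap
  · have : 1 ≤ (2 * i - blockCount m A p (2 * i) : ℝ) / (2 * i - θ) := by
      rw [le_div_iff₀ (by linarith)]; linarith
    linarith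
  have hG : Good θ m A p (2 * i) s := by
    refine ⟨?_, ?_, ?_, h4⟩
    · rw [show p + 2 * i / 2 - 1 = p + (i - 1) by omega]; exact h1
    · rw [show p + 2 * i - 1 = p + (2 * i - 1) by omega]; exact h2
    · rw [show 2 * i / 2 = i by omega]; exact h3
  have hD : (K : ℤ) ≤ |Dval m A p (2 * i)| := by
    by_contra h; exact hg ⟨hG, by omega⟩
  have hD' : (K : ℝ) ≤ |(Dval m A p (2 * i) : ℝ)| := by exact_mod_cast hD
  rw [imbalance_eq m A p i hi] at hD'
  have hl : IsLive c ε m A p (2 * i) := by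
    unfold IsLive blockDensity
    rw [le_div_iff₀ (by push_cast; linarith)]
    push_cast
    linarith
  have : 1 ≤ i / K * adjImbalance c ε m A p (2 * i) := by
    unfold adjImbalance
    rw [if_pos hl, div_mul_eq_mul_div, le_div_iff₀ hK0]; linarith
  linarith

lemma adj_nonneg (c ε : ℝ) (m : ℕ) (A : Fin m → Bool) (p j : ℕ) :
    0 ≤ adjImbalance c ε m A p j := by
  unfold adjImbalance imbalance
  split_ifs
  · positivity
  · exact le_rfl

lemma sum_pos_le {m n : ℕ} (A : Config m n) (T : Finset ℕ) (hT : ∀ t ∈ T, 1 ≤ t ∧ t ≤ n)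
    (f : ℕ → ℝ) (hf : ∀ p, 0 ≤ f p) :
    ∑ t ∈ T, f (posOf A.1 t) ≤ ∑ p ∈ Finset.range m, f p := by
  have hinj : Set.InjOn (posOf A.1) T := by
    intro a ha b hb hab
    have h1 := posOf_spec A a (hT a ha).1 (hT a ha).2
    have h2 := posOf_spec A b (hT b hb).1 (hT b hb).2
    rw [hab] at h1
    omega
  rw [← Finset.sum_image (f := f) hinj]
  refine Finset.sum_le_sum_of_subset_of_nonneg ?_ (fun p _ _ => hf p)
  intro p hp
  obtain ⟨t, ht, rfl⟩ := Finset.mem_image.1 hp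
  exact Finset.mem_range.2 (posOf_spec A t (hT t ht).1 (hT t ht).2).1

lemma sum_bad {m n : ℕ} (hm : 0 < m) (A : Config m n) (T : Finset ℕ)
    (hT : ∀ t ∈ T, 1 ≤ t ∧ t ≤ n)
    (c ε θ : ℝ) (K : ℕ) (hK : 0 < K) (i s : ℕ) (hi : 1 ≤ i)
    (hs : 3 * s ≤ 2 * i) (hθ : (1 - c * ε) * (2 * i) ≤ θ) (hθ2 : θ < 2 * i) :
    ∑ t ∈ T, (1 - goodF θ K m A.1 (posOf A.1 t) (2 * i) s) ≤
      2 * i * ((m : ℝ) - n) / (2 * i - θ) + 5 * ((m : ℝ) - n)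
      + i / K * (m * DeltaAvg c ε m A.1 (2 * i)) := by
  have hi0 : (0 : ℝ) < i := by exact_mod_cast hi
  have hm0 : (0 : ℝ) < m := by exact_mod_cast hm
  refine (sum_pos_le A T hT (fun p => 1 - goodF θ K m A.1 p (2 * i) s) ?_).trans ?_
  · intro p; have := goodF_le_one θ K m A.1 p (2 * i) s; linarith
  refine (Finset.sum_le_sum fun p _ => markov c ε θ K hK m A.1 p i s hi hs hθ hθ2).trans ?_
  simp only [Finset.sum_add_distrib, Finset.sum_sub_distrib, ← Finset.sum_div, ← Finset.mul_sum,
    sum_cyc, sum_blockCount]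
  simp only [Finset.sum_const, Finset.card_range, nsmul_eq_mul, mul_one]
  unfold DeltaAvg
  rw [mul_div_cancel₀ _ hm0.ne']
  push_cast
  apply le_of_eq
  field_simp
  ring

end Fin

set_option maxHeartbeats 1000000

theorem statement14 :
    ∃ c₀ : ℝ, 10 ≤ c₀ ∧ ∃ κ : ℝ, 0 < κ ∧
      ∀ c : ℝ, c₀ ≤ c → ∃ M : ℕ, ∀ m : ℕ, M ≤ m →
      ∀ n : ℕ, n ≤ m →
      ((m : ℝ) ^ (-(1 : ℝ) / 3) ≤ 1 - (n : ℝ) / m) → (1 - (n : ℝ) / m ≤ 1 / c) →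
      ∀ Mo : HIModel m n, ∀ j ∈ Jset m, ∀ s : ℕ,
      ((j : ℝ) / 6 ≤ s) → ((s : ℝ) ≤ (j : ℝ) / 3) →
      κ / ((⌊(j : ℝ) * DeltaExp c Mo j⌋₊ : ℝ) + 1) ≤ 1 -
        (1 / ((Finset.Icc ((n + 3) / 4 - s) (n / 2 - s)).card : ℝ)) *
          ∑ t ∈ Finset.Icc ((n + 3) / 4 - s) (n / 2 - s),
            pexp Mo.C0 (fun A => probNoCrit c Mo t (t + s) j 1 A) := by
  refine ⟨1000, by norm_num, 1 / 42, by norm_num, ?_⟩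
  intro c hc
  refine ⟨1000, ?_⟩
  intro m hm n hnm hε1 hε2 Mo j hj s hs1 hs2
  have hm0 : (1000 : ℝ) ≤ m := by exact_mod_cast hm
  have hmp : (0 : ℝ) < m := by linarith
  have hc0 : 0 < c := by linarith
  obtain ⟨e, he, rfl⟩ := Finset.mem_image.1 hj
  rw [Finset.mem_Icc] at he
  have hlog : 2 ^ (Nat.log 2 m) ≤ m := Nat.pow_log_le_self 2 (by omega)
  have hj4 : 4 * 2 ^ e ≤ m := by
    refine le_trans ?_ hlog
    rw [show 4 * 2 ^ e = 2 ^ (e + 2) by ring]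
    exact Nat.pow_le_pow_right (by norm_num) (by omega)
  obtain ⟨i, hi, hji⟩ : ∃ i, 1 ≤ i ∧ 2 ^ e = 2 * i := by
    refine ⟨2 ^ (e - 1), Nat.one_le_two_pow, ?_⟩
    rw [← pow_succ']
    congr 1
    omega
  simp only [hji] at *
  clear hj hlog
  have hi0 : (0 : ℝ) < i := by exact_mod_cast hi
  set ε : ℝ := 1 - (n : ℝ) / m with hε
  have hεm : (m : ℝ) - n = ε * m := by rw [hε]; field_simp
  have hcε : c * ε ≤ 1 := by
    have := (le_div_iff₀ hc0).1 hε2; linarith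
  have hεs : ε ≤ 1 / 1000 := hε2.trans (one_div_le_one_div_of_le (by norm_num) hc)
  have hεl : 2 / m ≤ ε := by
    refine le_trans ?_ hε1
    rw [div_le_iff₀ hmp]
    have h1 : (m : ℝ) ^ (-(1 : ℝ) / 3) * m = (m : ℝ) ^ ((2 : ℝ) / 3) := by
      nth_rewrite 2 [← Real.rpow_one (m : ℝ)]
      rw [← Real.rpow_add hmp]
      norm_num
    rw [h1]
    calc (2 : ℝ) ≤ 8 ^ ((2 : ℝ) / 3) := by
          rw [show (8 : ℝ) = 2 ^ (3 : ℝ) by norm_num, ← Real.rpow_mul (by norm_num)]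
          norm_num
      _ ≤ (m : ℝ) ^ ((2 : ℝ) / 3) :=
          Real.rpow_le_rpow (by norm_num) (by linarith) (by norm_num)
  have hεp : 0 < ε := lt_of_lt_of_le (by positivity) hεl
  have hnr : (999 : ℝ) * m ≤ 1000 * n := by nlinarith
  have hn : 999 * m ≤ 1000 * n := by exact_mod_cast hnr
  push_cast at hs1 hs2
  have hs1' : 1 ≤ s := by
    have : (0 : ℝ) < s := lt_of_lt_of_le (by positivity) hs1
    exact_mod_cast this
  have hs2' : 3 * s ≤ 2 * i := by
    have : 3 * (s : ℝ) ≤ 2 * i := by linarith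
    exact_mod_cast this
  set T := Finset.Icc ((n + 3) / 4 - s) (n / 2 - s) with hT
  have hLn : n ≤ 4 * T.card + 1 := by rw [hT, Nat.card_Icc]; omega
  have hTm : ∀ t ∈ T, 1 ≤ t ∧ 2 * (t + s) ≤ n := by
    intro t ht
    rw [hT, Finset.mem_Icc] at ht
    omega
  have hLr : (n : ℝ) ≤ 4 * (T.card : ℝ) + 1 := by exact_mod_cast hLn
  set L : ℝ := (T.card : ℝ) with hL
  set Δ := DeltaExp c Mo (2 * i) with hΔ
  set F : ℕ := ⌊((2 * i : ℕ) : ℝ) * Δ⌋₊ + 1 with hF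
  have hFr : (⌊((2 * i : ℕ) : ℝ) * Δ⌋₊ : ℝ) + 1 = F := by rw [hF]; push_cast; rfl
  have hFΔ : 2 * i * Δ ≤ F := by
    rw [← hFr]
    have := (Nat.lt_floor_add_one (((2 * i : ℕ) : ℝ) * Δ)).le
    push_cast at *
    exact this
  have hF1 : (1 : ℝ) ≤ F := by rw [← hFr]; linarith [Nat.cast_nonneg (α := ℝ) ⌊((2 * i : ℕ) : ℝ) * Δ⌋₊]
  rw [hFr]
  set K : ℕ := 10 * F with hK
  have hKr : (K : ℝ) = 10 * F := by rw [hK]; push_cast; rfl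
  have hK0 : 0 < K := by omega
  set θ : ℝ := (1 - c * ε / 2) * (2 * i) with hθ
  have hcεp : 0 < c * ε := by positivity
  have hθ1 : (1 - c * ε) * (2 * i) ≤ θ := by rw [hθ]; nlinarith
  have hθ2 : θ < 2 * i := by rw [hθ]; nlinarith
  have hθ3 : (1 - c * (1 - ((n : ℝ) + 1) / m)) * (2 * i) ≤ θ := by
    have h1 : 1 - ((n : ℝ) + 1) / m = ε - 1 / m := by rw [hε]; ring
    have h2 : (2 : ℝ) / m = 2 * (1 / m) := by ring
    rw [h1, hθ]
    refine mul_le_mul_of_nonneg_right ?_ (by positivity)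
    have : c * (2 * (1 / m)) ≤ c * ε := by rw [← h2]; exact mul_le_mul_of_nonneg_left hεl hc0.le
    linarith
  -- per-`t` inequality
  have hper : ∀ t ∈ T, pexp Mo.C0 (fun A => goodF θ K m A.1 (posOf A.1 t) (2 * i) s) ≤
      (2 * K + 1) * (1 - pexp Mo.C0 (fun A => probNoCrit c Mo t (t + s) (2 * i) 1 A)) := by
    intro t ht
    obtain ⟨ht1, ht2⟩ := hTm t ht
    refine prob_core c Mo t (t + s) (2 * i) (by omega) (by omega) _
      (fun A => (gF θ K m A.1 (posOf A.1 t) (2 * i) s : ℝ)) _ ?_ ?_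
    · intro A B
      have h1 := gF_bd θ K m A.1 (posOf A.1 t) (2 * i) s
      have h2 := gF_bd θ K m B.1 (posOf B.1 t) (2 * i) s
      have h3 := goodF_le_one θ K m A.1 (posOf A.1 t) (2 * i) s
      linarith [h1.2, h2.1]
    · intro A B A1 hI hD
      by_cases hg : Good θ m A.1 (posOf A.1 t) (2 * i) s
      · obtain ⟨g', d'⟩ := step_lemma c θ A B A1 t s (2 * i) ht1 hs1' (by omega) (by omega)
          (by push_cast; exact hθ1) (by push_cast; exact hθ3) hg hI hD
        simp only [gF, goodF, if_pos hg, if_pos g', d', hg, true_and]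
        split_ifs with h
        · rw [abs_lt] at h
          norm_cast
          omega
        · norm_cast
          omega
      · have h2 := gF_bd θ K m B.1 (posOf B.1 t) (2 * i) s
        simp only [goodF, hg, false_and, if_false]
        have : gF θ K m A.1 (posOf A.1 t) (2 * i) s = -K := by unfold gF; rw [if_neg hg]
        rw [this]
        push_cast
        linarith [h2.1]
  have hsum := Finset.sum_le_sum hper
  rw [← Finset.mul_sum, Finset.sum_sub_distrib] at hsum
  simp only [Finset.sum_const, nsmul_eq_mul, mul_one] at hsum
  rw [← hL] at hsum
  have hbad : pexp Mo.C0 (fun A => ∑ t ∈ T, (1 - goodF θ K m A.1 (posOf A.1 t) (2 * i) s)) ≤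
      pexp Mo.C0 (fun A => (2 * i * ((m : ℝ) - n) / (2 * i - θ) + 5 * ((m : ℝ) - n))
      + i / K * (m * DeltaAvg c ε m A.1 (2 * i))) := by
    refine Finset.sum_le_sum fun A _ => mul_le_mul_of_nonneg_left ?_ ENNReal.toReal_nonneg
    exact sum_bad (by omega) A T (fun t ht => ⟨(hTm t ht).1, by have := (hTm t ht).2; omega⟩)
      c ε θ K hK0 i s hi hs2' hθ1 hθ2
  have hone : ∑ A, (Mo.C0 A).toReal = 1 := by
    have := pexp_one Mo.C0
    simpa [pexp] using this
  have hbl : pexp Mo.C0 (fun A => ∑ t ∈ T, (1 - goodF θ K m A.1 (posOf A.1 t) (2 * i) s)) =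
      L - ∑ t ∈ T, pexp Mo.C0 (fun A => goodF θ K m A.1 (posOf A.1 t) (2 * i) s) := by
    simp only [pexp, Finset.sum_sub_distrib, mul_sub, Finset.mul_sum]
    congr 1
    · rw [Finset.sum_comm]
      simp [hone, hL]
    · rw [Finset.sum_comm]
  have hbr : pexp Mo.C0 (fun A => (2 * i * ((m : ℝ) - n) / (2 * i - θ) + 5 * ((m : ℝ) - n))
      + i / K * (m * DeltaAvg c ε m A.1 (2 * i))) =
      (2 * i * ((m : ℝ) - n) / (2 * i - θ) + 5 * ((m : ℝ) - n)) + i / K * (m * Δ) := by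
    have h1 : Δ = ∑ A, (Mo.C0 A).toReal * DeltaAvg c ε m A.1 (2 * i) := rfl
    simp only [pexp, mul_add, Finset.sum_add_distrib, ← Finset.sum_mul, hone, one_mul]
    rw [h1]
    simp only [Finset.mul_sum]
    congr 1
    refine Finset.sum_congr rfl fun A _ => by ring
  rw [hbl, hbr] at hbad
  have t1 : 2 * i * ((m : ℝ) - n) / (2 * i - θ) ≤ m / 500 := by
    have : 2 * i - θ = c * ε * i := by rw [hθ]; ring
    rw [this, hεm, div_le_div_iff₀ (by positivity) (by norm_num)]
    have h0 : 0 ≤ ε * m * i := by positivity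
    have h1 := mul_le_mul_of_nonneg_right hc h0
    linarith
  have t2 : 5 * ((m : ℝ) - n) ≤ m / 200 := by linarith
  have t3 : i / K * (m * Δ) ≤ m / 20 := by
    rw [hKr, div_mul_eq_mul_div, div_le_div_iff₀ (by positivity) (by norm_num)]
    have h1 := mul_le_mul_of_nonneg_left hFΔ hmp.le
    linarith
  have hL0 : 0 < L := by linarith
  have hgoodL : L / 2 ≤ ∑ t ∈ T, pexp Mo.C0 (fun A => goodF θ K m A.1 (posOf A.1 t) (2 * i) s) := by
    linarith
  set Q := ∑ t ∈ T, pexp Mo.C0 (fun A => probNoCrit c Mo t (t + s) (2 * i) 1 A) with hQ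
  have hfin : L / 2 ≤ (2 * K + 1) * (L - Q) := hgoodL.trans hsum
  rw [hKr] at hfin
  have hLQ : 0 ≤ L - Q := by
    by_contra h
    push Not at h
    have h1 : (2 * (10 * (F : ℝ)) + 1) * (L - Q) ≤ 0 :=
      mul_nonpos_of_nonneg_of_nonpos (by linarith) h.le
    linarith
  have h21 : L / 2 ≤ 21 * F * (L - Q) := by
    refine hfin.trans (mul_le_mul_of_nonneg_right ?_ hLQ)
    linarith
  have : 1 - 1 / L * Q = (L - Q) / L := by field_simp
  rw [this, div_le_div_iff₀ (by linarith) hL0]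
  linarith
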